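/- arXiv:1912.09727 — 3 statements merged into one kernel-verified Lean document; each statement's English description precedes it below -/
import Mathlib

section
/- (S-procedure sufficient condition for invariance.) Suppose Θ = ℝ^n, i.e., X = Ω. Fix k ∈ ℕ. If for every Q' ∈ 𝒬_{k+1} \ 𝒬_k there exists M ∈ cone(𝒬_k) with Q' ⪯ M, then O_{k+1} = O_k. -/
open Matrix

/-- The cone (set of nonnegative linear combinations) generated by a set of matrices. -/
def matCone {α : Type*} [AddCommMonoid α] [Module ℝ α] (S : Set α) : Set α :=
  { M | ∃ (t : Finset α) (c : α → ℝ), (↑t : Set α) ⊆ S ∧ (∀ x ∈ t, 0 ≤ c x) ∧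
      M = ∑ x ∈ t, c x • x }

theorem dotProduct_transpose_mul_mul_mulVec {m : Type*} [Fintype m]
    (B M : Matrix m m ℝ) (v : m → ℝ) :
    v ⬝ᵥ (Bᵀ * M * B) *ᵥ v = (B *ᵥ v) ⬝ᵥ M *ᵥ (B *ᵥ v) := by
  rw [← mulVec_mulVec, ← mulVec_mulVec, dotProduct_mulVec, vecMul_transpose]

theorem dotProduct_mulVec_nonpos_of_mem_matCone {m : Type*} [Fintype m]
    {S : Set (Matrix m m ℝ)} {v : m → ℝ} (hS : ∀ M ∈ S, v ⬝ᵥ M *ᵥ v ≤ 0)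
    {M : Matrix m m ℝ} (hM : M ∈ matCone S) : v ⬝ᵥ M *ᵥ v ≤ 0 := by
  obtain ⟨t, c, ht, hc, rfl⟩ := hM
  rw [sum_mulVec, dotProduct_sum]
  refine Finset.sum_nonpos fun N hN => ?_
  rw [smul_mulVec, dotProduct_smul]
  exact mul_nonpos_of_nonneg_of_nonpos (hc N hN) (hS N (ht hN))

theorem dotProduct_mulVec_le_of_posSemidef_sub {m : Type*} [Fintype m]
    {M N : Matrix m m ℝ} (h : (M - N).PosSemidef) (v : m → ℝ) :
    v ⬝ᵥ N *ᵥ v ≤ v ⬝ᵥ M *ᵥ v := by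
  have := h.dotProduct_mulVec_nonneg v
  rw [sub_mulVec, dotProduct_sub, star_trivial] at this
  linarith

/-- The homogenization of a quadratic polynomial, evaluated at `(x, 1)`. -/
theorem dotProduct_homogenization_mulVec {m : Type*} [Fintype m]
    (Q : Matrix m m ℝ) (q x : m → ℝ) :
    Sum.elim x (1 : Unit → ℝ) ⬝ᵥ (Matrix.fromBlocks Q (Matrix.of fun r (_ : Unit) => q r)
      (Matrix.of fun (_ : Unit) c => q c) (Matrix.of fun (_ : Unit) (_ : Unit) => (-1 : ℝ))) *ᵥ
        Sum.elim x (1 : Unit → ℝ) = x ⬝ᵥ Q *ᵥ x + 2 * (q ⬝ᵥ x) - 1 := by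
  have h₁ : (Matrix.of fun r (_ : Unit) => q r) *ᵥ (1 : Unit → ℝ) = q := by
    ext r
    simp [mulVec, dotProduct]
  have h₂ : (1 : Unit → ℝ) ⬝ᵥ ((Matrix.of fun (_ : Unit) c => q c) *ᵥ x +
      (Matrix.of fun (_ : Unit) (_ : Unit) => (-1 : ℝ)) *ᵥ (1 : Unit → ℝ)) = q ⬝ᵥ x - 1 := by
    simp [mulVec, dotProduct, sub_eq_add_neg]
  simp only [fromBlocks_mulVec, Sum.elim_comp_inl, Sum.elim_comp_inr]
  rw [sumElim_dotProduct_sumElim, h₁, h₂, dotProduct_add,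
    dotProduct_comm x q]
  ring

/-- S-procedure sufficient condition for invariance: if every new matrix
Q' ∈ 𝒬_{k+1} \ 𝒬_k is dominated (in the PSD order) by some element of cone(𝒬_k),
then O_{k+1} = O_k. -/
theorem sProcedure_invariance (n p : ℕ) (A : Matrix (Fin n) (Fin n) ℝ)
    (Q : Fin p → Matrix (Fin n) (Fin n) ℝ) (q : Fin p → Fin n → ℝ)
    (hQsymm : ∀ i, (Q i)ᵀ = Q i)
    (X : Set (Fin n → ℝ))
    (hX : X = {x : Fin n → ℝ | ∀ i : Fin p, x ⬝ᵥ (Q i).mulVec x + 2 * (q i ⬝ᵥ x) ≤ 1})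
    (O : ℕ → Set (Fin n → ℝ)) (hO0 : O 0 = X)
    (hOsucc : ∀ k : ℕ, O (k + 1) = O k ∩ {x : Fin n → ℝ | A.mulVec x ∈ O k})
    (Abar : Matrix (Fin n ⊕ Unit) (Fin n ⊕ Unit) ℝ)
    (hAbar : Abar = Matrix.fromBlocks A 0 0 1)
    (Qbar : Fin p → Matrix (Fin n ⊕ Unit) (Fin n ⊕ Unit) ℝ)
    (hQbar : ∀ i, Qbar i = Matrix.fromBlocks (Q i) (Matrix.of fun r (_ : Unit) => q i r)
      (Matrix.of fun (_ : Unit) c => q i c) (Matrix.of fun (_ : Unit) (_ : Unit) => (-1 : ℝ)))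
    (𝒬 : ℕ → Set (Matrix (Fin n ⊕ Unit) (Fin n ⊕ Unit) ℝ))
    (h𝒬0 : 𝒬 0 = Set.range Qbar)
    (h𝒬succ : ∀ k : ℕ, 𝒬 (k + 1) = 𝒬 k ∪ (fun M => Abarᵀ * M * Abar) '' 𝒬 k)
    (k : ℕ)
    (hdom : ∀ Q' ∈ 𝒬 (k + 1) \ 𝒬 k, ∃ M ∈ matCone (𝒬 k), (M - Q').PosSemidef) :
    O (k + 1) = O k := by
  have hA : ∀ x, Abar *ᵥ Sum.elim x (1 : Unit → ℝ) = Sum.elim (A *ᵥ x) 1 := fun x => by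
    simp [hAbar, fromBlocks_mulVec]
  have hO : ∀ k x, x ∈ O k ↔
      ∀ M ∈ 𝒬 k, Sum.elim x (1 : Unit → ℝ) ⬝ᵥ M *ᵥ Sum.elim x 1 ≤ 0 := by
    intro k
    induction k with
    | zero =>
      intro x
      simp only [hO0, hX, h𝒬0, Set.forall_mem_range, hQbar, dotProduct_homogenization_mulVec,
        Set.mem_ofPred_eq, sub_nonpos]
    | succ k ih =>
      intro x
      simp only [hOsucc, h𝒬succ, Set.mem_inter_iff, Set.mem_ofPred_eq, ih, Set.mem_union,
        or_imp, forall_and, Set.forall_mem_image, dotProduct_transpose_mul_mul_mulVec, hA]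
  ext x
  refine ⟨fun hx => ((hOsucc k).subset hx).1, fun hx => (hO (k + 1) x).2 fun N hN => ?_⟩
  rw [hO] at hx
  by_cases hNk : N ∈ 𝒬 k
  · exact hx N hNk
  · obtain ⟨M, hM, hMN⟩ := hdom N ⟨hN, hNk⟩
    exact (dotProduct_mulVec_le_of_posSemidef_sub hMN _).trans
      (dotProduct_mulVec_nonpos_of_mem_matCone hx hM)
end

section
/- (Soundness of the quadratic relaxation.) Under Assumption Q (quasi-smoothness of the H_i on Ω), for every k ∈ ℕ one has O_k ⊆ Õ_k, where Õ_k := {x ∈ ℝ^n : (x,1)ᵀ M (x,1) ≤ 0 for all M ∈ 𝒬_k ∪ ℋ^l_k}. -/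
open Matrix

theorem lift_dotProduct_fromBlocks_mulVec {ι R : Type*} [Fintype ι] [CommRing R]
    (P : Matrix ι ι R) (u v x : ι → R) (c : R) :
    (Sum.elim x fun _ : Unit => (1 : R)) ⬝ᵥ
        (Matrix.fromBlocks P (Matrix.of fun r (_ : Unit) => u r)
          (Matrix.of fun (_ : Unit) s => v s)
          (Matrix.of fun (_ : Unit) (_ : Unit) => c)).mulVec (Sum.elim x fun _ => 1) =
      x ⬝ᵥ P.mulVec x + (u ⬝ᵥ x + v ⬝ᵥ x) + c := by
  have hu : (Matrix.of fun r (_ : Unit) => u r).mulVec (fun _ => 1) = u := by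
    ext r; simp [Matrix.mulVec, dotProduct]
  have hv : (Matrix.of fun (_ : Unit) s => v s).mulVec x = fun _ => v ⬝ᵥ x := rfl
  have hc : (Matrix.of fun (_ : Unit) (_ : Unit) => c).mulVec (fun _ => 1) = fun _ => c := by
    ext r; simp [Matrix.mulVec, dotProduct]
  rw [Matrix.fromBlocks_mulVec]
  simp only [Sum.elim_comp_inl, Sum.elim_comp_inr, hu, hv, hc, sumElim_dotProduct_sumElim,
    dotProduct_add]
  simp [dotProduct, mul_comm]
  ring

theorem dotProduct_transpose_mul_mul_mulVec_s10 {ι R : Type*} [Fintype ι] [CommRing R]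
    (B M : Matrix ι ι R) (y : ι → R) :
    y ⬝ᵥ (Bᵀ * M * B).mulVec y = B.mulVec y ⬝ᵥ M.mulVec (B.mulVec y) := by
  rw [← Matrix.mulVec_mulVec, ← Matrix.mulVec_mulVec, Matrix.dotProduct_mulVec,
    Matrix.vecMul_transpose]

theorem fromBlocks_zero_one_mulVec_lift {ι R : Type*} [Fintype ι] [CommRing R]
    (A : Matrix ι ι R) (x : ι → R) :
    (Matrix.fromBlocks A 0 0 (1 : Matrix Unit Unit R)).mulVec (Sum.elim x fun _ => 1) =
      Sum.elim (A.mulVec x) fun _ => 1 := by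
  simp [Matrix.fromBlocks_mulVec]

/-- Soundness of the quadratic relaxation: under the quasi-smoothness assumption on the
nonlinear constraint functions H_i, for every k one has O_k ⊆ Õ_k, where Õ_k is cut out
by the quadratic constraints 𝒬_k ∪ ℋ^l_k. -/
theorem relaxation_soundness (n p m : ℕ)
    (A : Matrix (Fin n) (Fin n) ℝ)
    (Q : Fin p → Matrix (Fin n) (Fin n) ℝ) (q : Fin p → Fin n → ℝ)
    (hQsymm : ∀ i, (Q i)ᵀ = Q i)
    (Ω : Set (Fin n → ℝ))
    (hΩ : Ω = {x : Fin n → ℝ | ∀ i : Fin p, x ⬝ᵥ (Q i).mulVec x + 2 * (q i ⬝ᵥ x) ≤ 1})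
    (H : Fin m → (Fin n → ℝ) → ℝ)
    (hHcont : ∀ i, Continuous (H i)) (hH0 : ∀ i, H i 0 = 0)
    (G : Fin m → Fin n → ℝ) (L : Fin m → ℝ) (hL : ∀ i, 0 ≤ L i)
    (hquasi : ∀ i : Fin m, ∀ x ∈ Ω, |H i x - H i 0 - G i ⬝ᵥ x| ≤ L i / 2 * (x ⬝ᵥ x))
    (Θ : Set (Fin n → ℝ)) (hΘ : Θ = {x : Fin n → ℝ | ∀ i : Fin m, H i x ≤ 1})
    (X : Set (Fin n → ℝ)) (hX : X = Ω ∩ Θ)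
    (O : ℕ → Set (Fin n → ℝ)) (hO0 : O 0 = X)
    (hOsucc : ∀ k : ℕ, O (k + 1) = O k ∩ {x : Fin n → ℝ | A.mulVec x ∈ O k})
    (Abar : Matrix (Fin n ⊕ Unit) (Fin n ⊕ Unit) ℝ)
    (hAbar : Abar = Matrix.fromBlocks A 0 0 1)
    (Qbar : Fin p → Matrix (Fin n ⊕ Unit) (Fin n ⊕ Unit) ℝ)
    (hQbar : ∀ i, Qbar i = Matrix.fromBlocks (Q i) (Matrix.of fun r (_ : Unit) => q i r)
      (Matrix.of fun (_ : Unit) c => q i c) (Matrix.of fun (_ : Unit) (_ : Unit) => (-1 : ℝ)))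
    (Hlbar : Fin m → Matrix (Fin n ⊕ Unit) (Fin n ⊕ Unit) ℝ)
    (hHlbar : ∀ i, Hlbar i = Matrix.fromBlocks (-(L i / 2) • (1 : Matrix (Fin n) (Fin n) ℝ))
      (Matrix.of fun r (_ : Unit) => G i r / 2)
      (Matrix.of fun (_ : Unit) c => G i c / 2)
      (Matrix.of fun (_ : Unit) (_ : Unit) => H i 0 - 1))
    (𝒬 : ℕ → Set (Matrix (Fin n ⊕ Unit) (Fin n ⊕ Unit) ℝ))
    (h𝒬0 : 𝒬 0 = Set.range Qbar)
    (h𝒬succ : ∀ k : ℕ, 𝒬 (k + 1) = 𝒬 k ∪ (fun M => Abarᵀ * M * Abar) '' 𝒬 k)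
    (ℋl : ℕ → Set (Matrix (Fin n ⊕ Unit) (Fin n ⊕ Unit) ℝ))
    (hℋl0 : ℋl 0 = Set.range Hlbar)
    (hℋlsucc : ∀ k : ℕ, ℋl (k + 1) = ℋl k ∪ (fun M => Abarᵀ * M * Abar) '' ℋl k)
    (k : ℕ) :
    O k ⊆ {x : Fin n → ℝ | ∀ M ∈ 𝒬 k ∪ ℋl k,
      (Sum.elim x fun _ => (1 : ℝ)) ⬝ᵥ M.mulVec (Sum.elim x fun _ => (1 : ℝ)) ≤ 0} := by
  have pullback (M : Matrix (Fin n ⊕ Unit) (Fin n ⊕ Unit) ℝ) (x : Fin n → ℝ) :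
      (Sum.elim x fun _ => (1 : ℝ)) ⬝ᵥ
          (Abarᵀ * M * Abar).mulVec (Sum.elim x fun _ => (1 : ℝ)) =
        (Sum.elim (A.mulVec x) fun _ => (1 : ℝ)) ⬝ᵥ
          M.mulVec (Sum.elim (A.mulVec x) fun _ => (1 : ℝ)) := by
    rw [dotProduct_transpose_mul_mul_mulVec_s10, hAbar, fromBlocks_zero_one_mulVec_lift]
  induction k with
  | zero =>
    intro x hx M hM
    rw [hO0, hX] at hx
    obtain ⟨hxΩ, hxΘ⟩ := hx
    rw [h𝒬0, hℋl0] at hM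
    rcases hM with ⟨i, rfl⟩ | ⟨i, rfl⟩
    · rw [hΩ] at hxΩ
      rw [hQbar, lift_dotProduct_fromBlocks_mulVec]
      linarith [hxΩ i]
    · rw [hΘ] at hxΘ
      have hhalf : (fun r => G i r / 2) ⬝ᵥ x = G i ⬝ᵥ x / 2 := by
        simp only [dotProduct, Finset.sum_div]
        exact Finset.sum_congr rfl fun _ _ => by ring
      rw [hHlbar, lift_dotProduct_fromBlocks_mulVec, hhalf, Matrix.smul_mulVec,
        Matrix.one_mulVec, dotProduct_smul, smul_eq_mul]
      linarith [hxΘ i, neg_le_of_abs_le (hquasi i x hxΩ)]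
  | succ k ih =>
    intro x hx M hM
    rw [hOsucc] at hx
    obtain ⟨hxk, hAx⟩ := hx
    rw [h𝒬succ, hℋlsucc] at hM
    rcases hM with (hM | ⟨N, hN, rfl⟩) | (hM | ⟨N, hN, rfl⟩)
    · exact ih hxk M (Or.inl hM)
    · exact (pullback N x).trans_le (ih hAx N (Or.inl hN))
    · exact ih hxk M (Or.inr hM)
    · exact (pullback N x).trans_le (ih hAx N (Or.inr hN))
end

section
/- (Finite feasibility with nonlinear constraints.) Suppose A^k → 0 as k → ∞ (equivalently, A is Schur stable), Ω is compact with the origin in its interior, Assumption Q holds, and Q_1 = (1/D_x) I_n with q_1 = 0 for some D_x > 0. Then: (i) for every i ∈ {1,…,p} there exists a finite k_i ∈ ℕ and M ∈ cone(𝒬_{k_i} ∪ ℋ^l_{k_i}) with (Ā^{k_i+1})ᵀ Q̄_i Ā^{k_i+1} ⪯ M; (ii) for every i ∈ {1,…,m} there exists a finite k_i ∈ ℕ and M ∈ cone(𝒬_{k_i} ∪ ℋ^l_{k_i}) with (Ā^{k_i+1})ᵀ H̄_i^u Ā^{k_i+1} ⪯ M. -/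
open Matrix

/-- A symmetric matrix sequence tending to zero is eventually dominated by any positive
multiple of the identity. -/
theorem eventually_posSemidef_smul_one_sub {ι : Type*} [Fintype ι] [DecidableEq ι]
    (E : ℕ → Matrix ι ι ℝ) (hsymm : ∀ k, (E k)ᵀ = E k)
    (hE : Filter.Tendsto E Filter.atTop (nhds 0)) {d : ℝ} (hd : 0 < d) :
    ∀ᶠ k in Filter.atTop, (d • (1 : Matrix ι ι ℝ) - E k).PosSemidef := by
  have hS : Filter.Tendsto (fun k => ∑ i, ∑ j, |E k i j|) Filter.atTop (nhds 0) := by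
    have hcont : Continuous fun M : Matrix ι ι ℝ => ∑ i, ∑ j, |M i j| := by fun_prop
    simpa [Function.comp_def] using (hcont.tendsto 0).comp hE
  filter_upwards [hS.eventually (gt_mem_nhds hd)] with k hk
  refine PosSemidef.of_dotProduct_mulVec_nonneg ?_ fun x => ?_
  · simp [IsHermitian, conjTranspose_eq_transpose_of_trivial, hsymm k]
  · have hsq : ∀ i, x i ^ 2 ≤ x ⬝ᵥ x := fun i => by
      rw [sq]
      exact Finset.single_le_sum (f := fun j => x j * x j) (fun j _ => mul_self_nonneg _)
        (Finset.mem_univ i)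
    have hx : 0 ≤ x ⬝ᵥ x := Finset.sum_nonneg fun i _ => mul_self_nonneg (x i)
    have hle : x ⬝ᵥ (E k *ᵥ x) ≤ (∑ i, ∑ j, |E k i j|) * (x ⬝ᵥ x) := by
      rw [Finset.sum_mul]
      refine Finset.sum_le_sum fun i _ => ?_
      rw [mulVec, dotProduct, Finset.mul_sum, Finset.sum_mul]
      refine Finset.sum_le_sum fun j _ => ?_
      have hxx : |x i * x j| ≤ x ⬝ᵥ x := by
        rw [abs_le]
        constructor <;> nlinarith [hsq i, hsq j, sq_nonneg (x i - x j), sq_nonneg (x i + x j)]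
      calc x i * (E k i j * x j) ≤ |x i * (E k i j * x j)| := le_abs_self _
        _ = |E k i j| * |x i * x j| := by rw [← abs_mul]; congr 1; ring
        _ ≤ |E k i j| * (x ⬝ᵥ x) := by gcongr
    have hmul := mul_le_mul_of_nonneg_right hk.le hx
    simp only [star_trivial, sub_mulVec, dotProduct_sub, smul_mulVec, one_mulVec,
      dotProduct_smul, smul_eq_mul]
    linarith

/-- Under powers of a Schur stable matrix, every quadratic constraint whose constant term is `-1`
is eventually dominated by half of the ball constraint. -/
theorem exists_posSemidef_half_ball_sub {n : ℕ} {A : Matrix (Fin n) (Fin n) ℝ}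
    (hA : Filter.Tendsto (fun k : ℕ => A ^ k) Filter.atTop (nhds 0))
    {P : Matrix (Fin n) (Fin n) ℝ} (hP : Pᵀ = P) (g : Fin n → ℝ) {D : ℝ} (hD : 0 < D) :
    ∃ k : ℕ, ((1 / 2 : ℝ) • fromBlocks ((1 / D) • (1 : Matrix (Fin n) (Fin n) ℝ)) 0 0
        (Matrix.of fun (_ : Unit) (_ : Unit) => (-1 : ℝ)) -
      (fromBlocks A 0 0 (1 : Matrix Unit Unit ℝ) ^ (k + 1))ᵀ *
        fromBlocks P (Matrix.of fun r (_ : Unit) => g r) (Matrix.of fun (_ : Unit) c => g c)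
          (Matrix.of fun (_ : Unit) (_ : Unit) => (-1 : ℝ)) *
        fromBlocks A 0 0 (1 : Matrix Unit Unit ℝ) ^ (k + 1)).PosSemidef := by
  set C : Matrix (Fin n) Unit ℝ := Matrix.of fun r _ => g r
  have hC : (Matrix.of fun (_ : Unit) c => g c) = Cᵀ := rfl
  have hneg : (Matrix.of fun (_ : Unit) (_ : Unit) => (-1 : ℝ)) = -1 := by ext i j; simp
  rw [hC, hneg]
  let F : Matrix (Fin n) (Fin n) ℝ → Matrix (Fin n ⊕ Unit) (Fin n ⊕ Unit) ℝ :=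
    fun B => fromBlocks (Bᵀ * P * B) (Bᵀ * C) (Cᵀ * B) 0
  have hF : Continuous F := by
    refine Continuous.matrix_fromBlocks ?_ ?_ ?_ continuous_const <;> fun_prop
  have hlim : Filter.Tendsto (fun k => F (A ^ (k + 1))) Filter.atTop (nhds 0) := by
    have h0 : F 0 = 0 := by simp [F]
    simpa [h0, Function.comp_def] using
      (hF.tendsto 0).comp (hA.comp (Filter.tendsto_add_atTop_nat 1))
  have hsymm : ∀ k, (F (A ^ (k + 1)))ᵀ = F (A ^ (k + 1)) := fun k => by
    simp [F, fromBlocks_transpose, transpose_mul, hP, Matrix.mul_assoc]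
  set d : ℝ := min (1 / 2 * (1 / D)) (1 / 2)
  have hd : 0 < d := by positivity
  obtain ⟨k, hk⟩ := (eventually_posSemidef_smul_one_sub _ hsymm hlim hd).exists
  have hdiag : (diagonal (Sum.elim (fun _ : Fin n => 1 / 2 * (1 / D) - d)
      (fun _ : Unit => 1 / 2 - d))).PosSemidef := by
    refine PosSemidef.diagonal fun i => ?_
    rcases i with i | i
    · exact sub_nonneg.2 (min_le_left _ _)
    · exact sub_nonneg.2 (min_le_right _ _)
  refine ⟨k, ?_⟩
  convert hdiag.add hk using 1
  rw [fromBlocks_diagonal_pow, one_pow]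
  simp only [F, fromBlocks_transpose, fromBlocks_multiply]
  ext (i | i) (j | j) <;>
    simp [diagonal_apply, one_apply] <;> (try split_ifs) <;> ring

/-- Nonnegative multiples of a generator belong to the cone. -/
theorem smul_mem_matCone {α : Type*} [AddCommMonoid α] [Module ℝ α] {S : Set α} {x : α}
    (hx : x ∈ S) {c : ℝ} (hc : 0 ≤ c) : c • x ∈ matCone S :=
  ⟨{x}, fun _ => c, by simpa using hx, fun _ _ => hc, by simp⟩

/-- Finite feasibility with nonlinear constraints: under Schur stability of A,
compactness of Ω with 0 in its interior, quasi-smoothness of the H_i, and the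
redundant ball constraint Q_1 = (1/D_x)I, q_1 = 0, each of the matrices
(Ā^{k+1})ᵀ Q̄_i Ā^{k+1} and (Ā^{k+1})ᵀ H̄_i^u Ā^{k+1} is eventually dominated by an
element of cone(𝒬_k ∪ ℋ^l_k) for some finite k. -/
theorem finite_feasibility_nonlinear (n p m : ℕ) (hp : 0 < p)
    (A : Matrix (Fin n) (Fin n) ℝ)
    (hA : Filter.Tendsto (fun k : ℕ => A ^ k) Filter.atTop (nhds 0))
    (Q : Fin p → Matrix (Fin n) (Fin n) ℝ) (q : Fin p → Fin n → ℝ)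
    (hQsymm : ∀ i, (Q i)ᵀ = Q i)
    (Ω : Set (Fin n → ℝ))
    (hΩ : Ω = {x : Fin n → ℝ | ∀ i : Fin p, x ⬝ᵥ (Q i).mulVec x + 2 * (q i ⬝ᵥ x) ≤ 1})
    (hΩcompact : IsCompact Ω) (hΩint : (0 : Fin n → ℝ) ∈ interior Ω)
    (Dx : ℝ) (hDx : 0 < Dx)
    (hQ1 : Q ⟨0, hp⟩ = (1 / Dx) • (1 : Matrix (Fin n) (Fin n) ℝ))
    (hq1 : q ⟨0, hp⟩ = 0)
    (H : Fin m → (Fin n → ℝ) → ℝ)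
    (hHcont : ∀ i, Continuous (H i)) (hH0 : ∀ i, H i 0 = 0)
    (G : Fin m → Fin n → ℝ) (L : Fin m → ℝ) (hL : ∀ i, 0 ≤ L i)
    (hquasi : ∀ i : Fin m, ∀ x ∈ Ω, |H i x - H i 0 - G i ⬝ᵥ x| ≤ L i / 2 * (x ⬝ᵥ x))
    (Abar : Matrix (Fin n ⊕ Unit) (Fin n ⊕ Unit) ℝ)
    (hAbar : Abar = Matrix.fromBlocks A 0 0 1)
    (Qbar : Fin p → Matrix (Fin n ⊕ Unit) (Fin n ⊕ Unit) ℝ)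
    (hQbar : ∀ i, Qbar i = Matrix.fromBlocks (Q i) (Matrix.of fun r (_ : Unit) => q i r)
      (Matrix.of fun (_ : Unit) c => q i c) (Matrix.of fun (_ : Unit) (_ : Unit) => (-1 : ℝ)))
    (Hubar : Fin m → Matrix (Fin n ⊕ Unit) (Fin n ⊕ Unit) ℝ)
    (hHubar : ∀ i, Hubar i = Matrix.fromBlocks ((L i / 2) • (1 : Matrix (Fin n) (Fin n) ℝ))
      (Matrix.of fun r (_ : Unit) => G i r / 2)
      (Matrix.of fun (_ : Unit) c => G i c / 2)
      (Matrix.of fun (_ : Unit) (_ : Unit) => H i 0 - 1))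
    (Hlbar : Fin m → Matrix (Fin n ⊕ Unit) (Fin n ⊕ Unit) ℝ)
    (hHlbar : ∀ i, Hlbar i = Matrix.fromBlocks (-(L i / 2) • (1 : Matrix (Fin n) (Fin n) ℝ))
      (Matrix.of fun r (_ : Unit) => G i r / 2)
      (Matrix.of fun (_ : Unit) c => G i c / 2)
      (Matrix.of fun (_ : Unit) (_ : Unit) => H i 0 - 1))
    (𝒬 : ℕ → Set (Matrix (Fin n ⊕ Unit) (Fin n ⊕ Unit) ℝ))
    (h𝒬0 : 𝒬 0 = Set.range Qbar)
    (h𝒬succ : ∀ k : ℕ, 𝒬 (k + 1) = 𝒬 k ∪ (fun M => Abarᵀ * M * Abar) '' 𝒬 k)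
    (ℋl : ℕ → Set (Matrix (Fin n ⊕ Unit) (Fin n ⊕ Unit) ℝ))
    (hℋl0 : ℋl 0 = Set.range Hlbar)
    (hℋlsucc : ∀ k : ℕ, ℋl (k + 1) = ℋl k ∪ (fun M => Abarᵀ * M * Abar) '' ℋl k) :
    (∀ i : Fin p, ∃ ki : ℕ, ∃ M ∈ matCone (𝒬 ki ∪ ℋl ki),
      (M - (Abar ^ (ki + 1))ᵀ * Qbar i * Abar ^ (ki + 1)).PosSemidef) ∧
    (∀ i : Fin m, ∃ ki : ℕ, ∃ M ∈ matCone (𝒬 ki ∪ ℋl ki),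
      (M - (Abar ^ (ki + 1))ᵀ * Hubar i * Abar ^ (ki + 1)).PosSemidef) := by
  have hmono : ∀ k, Qbar ⟨0, hp⟩ ∈ 𝒬 k := fun k => by
    induction k with
    | zero => exact h𝒬0 ▸ Set.mem_range_self _
    | succ k ih => exact h𝒬succ k ▸ Or.inl ih
  have hball : Qbar ⟨0, hp⟩ = fromBlocks ((1 / Dx) • (1 : Matrix (Fin n) (Fin n) ℝ)) 0 0
      (Matrix.of fun (_ : Unit) (_ : Unit) => (-1 : ℝ)) := by
    rw [hQbar, hQ1, hq1]
    rfl
  have hmem : ∀ k, (1 / 2 : ℝ) • Qbar ⟨0, hp⟩ ∈ matCone (𝒬 k ∪ ℋl k) := fun k =>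
    smul_mem_matCone (Set.mem_union_left _ (hmono k)) (by norm_num)
  refine ⟨fun i => ?_, fun i => ?_⟩
  · obtain ⟨k, hk⟩ := exists_posSemidef_half_ball_sub hA (hQsymm i) (q i) hDx
    refine ⟨k, _, hmem k, ?_⟩
    rw [hball, hQbar, hAbar]
    exact hk
  · obtain ⟨k, hk⟩ := exists_posSemidef_half_ball_sub hA
      (P := (L i / 2) • (1 : Matrix (Fin n) (Fin n) ℝ)) (by simp) (fun r => G i r / 2) hDx
    refine ⟨k, _, hmem k, ?_⟩
    rw [hball, hHubar, hAbar, hH0, zero_sub]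
    exact hk
end
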